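/- Reduction to Max-Reward-Light (XOS case): Let (A, f, c) be a multi-agent contract instance with XOS f and A nonempty, let B ∈ (0,1] be a budget, let φ be a BEST objective, and let γ ≥ 1. Suppose S ⊆ L satisfies p(S) ≤ B and γ·f(S) ≥ Max-Reward-Light(B). Then there exists a set T ⊆ A with p(T) ≤ B, where T is either a singleton or a subset of S, such that (40γ + 1)·φ(T) ≥ Max-φ(B). -/

import Mathlib

open scoped BigOperators ENNReal
open Finset

/-- Marginal contribution of agent `i` to set `S`: `f_S(i) = f(S) - f(S \ {i})`. -/
noncomputable def marginal {α : Type*} [DecidableEq α] (f : Finset α → ℝ) (S : Finset α)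
    (i : α) : ℝ :=
  f S - f (S.erase i)

/-- Payment needed to incentivize `S`, valued in `[0,∞]`, with the conventions
`0/0 = 0` and `x/0 = ∞` for `x > 0` (these hold for ENNReal division). -/
noncomputable def payment {α : Type*} [DecidableEq α] (f : Finset α → ℝ) (c : α → ℝ)
    (S : Finset α) : ℝ≥0∞ :=
  ∑ i ∈ S, ENNReal.ofReal (c i) / ENNReal.ofReal (marginal f S i)

/-- The principal's profit from incentivizing `S`: `g(S) = (1 - p(S)) · f(S)`. -/
noncomputable def profit {α : Type*} [DecidableEq α] (f : Finset α → ℝ) (c : α → ℝ)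
    (S : Finset α) : ℝ :=
  (1 - (payment f c S).toReal) * f S

/-- `f` is monotone. -/
def IsMonotoneFn {α : Type*} (f : Finset α → ℝ) : Prop :=
  ∀ ⦃S T : Finset α⦄, S ⊆ T → f S ≤ f T

/-- `f` is subadditive. -/
def IsSubadditive {α : Type*} [DecidableEq α] (f : Finset α → ℝ) : Prop :=
  ∀ S T : Finset α, f (S ∪ T) ≤ f S + f T

/-- `f` is submodular (decreasing marginal values). -/
def IsSubmodular {α : Type*} [DecidableEq α] (f : Finset α → ℝ) : Prop :=
  ∀ ⦃S T : Finset α⦄, S ⊆ T → ∀ i ∉ T, f (insert i T) - f T ≤ f (insert i S) - f S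

/-- `f` is additive. -/
def IsAdditive {α : Type*} [DecidableEq α] (f : Finset α → ℝ) : Prop :=
  ∀ S : Finset α, f S = ∑ i ∈ S, f {i}

/-- `f` is XOS: a finite max of nonnegative additive functions. -/
def IsXOS {α : Type*} (f : Finset α → ℝ) : Prop :=
  ∃ (k : ℕ) (a : Fin (k + 1) → α → ℝ),
    (∀ j i, 0 ≤ a j i) ∧
    ∀ S : Finset α, f S = Finset.univ.sup' Finset.univ_nonempty (fun j => ∑ i ∈ S, a j i)

/-- Agent `i` is light: it can be incentivized with payment at most `1/2`. -/
def isLight {α : Type*} [DecidableEq α] (f : Finset α → ℝ) (c : α → ℝ) (i : α) : Prop :=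
  payment f c {i} ≤ ENNReal.ofReal (1 / 2)

/-- `S` is budget-feasible for budget `B`. -/
def feasible {α : Type*} [DecidableEq α] (f : Finset α → ℝ) (c : α → ℝ) (B : ℝ)
    (S : Finset α) : Prop :=
  payment f c S ≤ ENNReal.ofReal B

/-- `S` is a budget-feasible set of light agents. -/
def feasibleLight {α : Type*} [DecidableEq α] (f : Finset α → ℝ) (c : α → ℝ) (B : ℝ)
    (S : Finset α) : Prop :=
  (∀ i ∈ S, isLight f c i) ∧ payment f c S ≤ ENNReal.ofReal B

/-- The maximum (supremum) value of objective `φ` over sets satisfying `P`. -/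
noncomputable def maxVal {α : Type*} (φ : Finset α → ℝ) (P : Finset α → Prop) : ℝ :=
  sSup (φ '' {S | P S})

/-- `φ` is a BEST objective for the instance `(f, c)`: it is nonnegative, sandwiched between
profit and reward, and satisfies `φ(S) ≤ f(S \ {i}) + φ({i})` for `i ∈ S`. -/
def IsBEST {α : Type*} [DecidableEq α] (f : Finset α → ℝ) (c : α → ℝ)
    (φ : Finset α → ℝ) : Prop :=
  (∀ S, 0 ≤ φ S) ∧
  (∀ S, φ S ≤ f S) ∧
  (∀ S, payment f c S ≤ 1 → (1 - (payment f c S).toReal) * f S ≤ φ S) ∧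
  (∀ S, ∀ i ∈ S, φ S ≤ f (S.erase i) + φ {i})

/-- `φ` is a BEST objective for the instance `(f, c)` restricted to sets satisfying `P`. -/
def IsBESTOn {α : Type*} [DecidableEq α] (f : Finset α → ℝ) (c : α → ℝ)
    (P : Finset α → Prop) (φ : Finset α → ℝ) : Prop :=
  (∀ S, P S → 0 ≤ φ S) ∧
  (∀ S, P S → φ S ≤ f S) ∧
  (∀ S, P S → payment f c S ≤ 1 → (1 - (payment f c S).toReal) * f S ≤ φ S) ∧
  (∀ S, P S → ∀ i ∈ S, φ S ≤ f (S.erase i) + φ {i})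

theorem IsXOS.isMonotoneFn {α : Type*} {f : Finset α → ℝ} (hf : IsXOS f) :
    IsMonotoneFn f := by
  obtain ⟨k, a, ha, hfa⟩ := hf
  intro S T hST
  rw [hfa S, hfa T]
  refine Finset.sup'_mono_fun fun j _ => ?_
  exact Finset.sum_le_sum_of_subset_of_nonneg hST fun i _ _ => ha j i

theorem IsXOS.isSubadditive {α : Type*} [DecidableEq α] {f : Finset α → ℝ} (hf : IsXOS f) :
    IsSubadditive f := by
  obtain ⟨k, a, ha, hfa⟩ := hf
  intro S T
  rw [hfa (S ∪ T)]
  refine Finset.sup'_le _ _ fun j _ => ?_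
  have hS : ∑ i ∈ S, a j i ≤ f S := by
    rw [hfa S]
    exact Finset.le_sup' (fun j => ∑ i ∈ S, a j i) (Finset.mem_univ j)
  have hT : ∑ i ∈ T, a j i ≤ f T := by
    rw [hfa T]
    exact Finset.le_sup' (fun j => ∑ i ∈ T, a j i) (Finset.mem_univ j)
  have hU := Finset.sum_union_inter (s₁ := S) (s₂ := T) (f := a j)
  have hI : 0 ≤ ∑ i ∈ S ∩ T, a j i := Finset.sum_nonneg fun i _ => ha j i
  linarith

/-- The marginals with respect to `S` of the members of `R ⊆ S` sum to at most `f R`. -/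
theorem IsXOS.sum_marginal_le {α : Type*} [DecidableEq α] {f : Finset α → ℝ} (hf : IsXOS f)
    {R S : Finset α} (hRS : R ⊆ S) : ∑ i ∈ R, marginal f S i ≤ f R := by
  obtain ⟨k, a, ha, hfa⟩ := hf
  have hle : ∀ (j : Fin (k + 1)) (U : Finset α), ∑ i ∈ U, a j i ≤ f U := by
    intro j U
    rw [hfa U]
    exact Finset.le_sup' (fun j => ∑ i ∈ U, a j i) (Finset.mem_univ j)
  obtain ⟨j, -, hj⟩ := Finset.exists_mem_eq_sup' Finset.univ_nonempty
    (fun j => ∑ i ∈ S, a j i)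
  rw [← hfa S] at hj
  refine (Finset.sum_le_sum fun i hi => ?_).trans (hle j R)
  have h1 := hle j (S.erase i)
  have h2 := Finset.add_sum_erase S (a j) (hRS hi)
  unfold marginal
  linarith

theorem IsMonotoneFn.marginal_nonneg {α : Type*} [DecidableEq α] {f : Finset α → ℝ}
    (hf : IsMonotoneFn f) (S : Finset α) (i : α) : 0 ≤ marginal f S i :=
  sub_nonneg.2 (hf (Finset.erase_subset i S))

/-- Every `V ⊆ S` has a subset that keeps a `1 - δ` fraction of the reward and in which each
marginal is at least a `δ` fraction of the marginal with respect to `S`. -/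
theorem IsXOS.exists_subset_marginal_ge {α : Type*} [DecidableEq α] {f : Finset α → ℝ}
    (hf : IsXOS f) {V S : Finset α} (hVS : V ⊆ S) {δ : ℝ} (hδ : 0 ≤ δ) :
    ∃ T ⊆ V, (1 - δ) * f V ≤ f T ∧ ∀ i ∈ T, δ * marginal f S i ≤ marginal f T i := by
  obtain ⟨T, hT, hmax⟩ := Finset.exists_max_image V.powerset
    (fun T => f T - δ * ∑ i ∈ T, marginal f S i) ⟨V, Finset.mem_powerset_self V⟩
  rw [Finset.mem_powerset] at hT
  refine ⟨T, hT, ?_, fun i hi => ?_⟩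
  · have h1 := hmax V (Finset.mem_powerset_self V)
    have h2 := mul_le_mul_of_nonneg_left (hf.sum_marginal_le hVS) hδ
    have h3 : 0 ≤ δ * ∑ i ∈ T, marginal f S i :=
      mul_nonneg hδ (Finset.sum_nonneg fun i _ => hf.isMonotoneFn.marginal_nonneg S i)
    linarith
  · have h1 := hmax (T.erase i) (Finset.mem_powerset.2 ((Finset.erase_subset i T).trans hT))
    have h2 := Finset.add_sum_erase T (marginal f S) hi
    rw [← h2] at h1
    rw [marginal.eq_def f T i]
    linarith

theorem IsXOS.exists_subset_payment_le {α : Type*} [DecidableEq α] {f : Finset α → ℝ}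
    (hf : IsXOS f) (c : α → ℝ) {V S : Finset α} (hVS : V ⊆ S) {δ : ℝ} (hδ : 0 < δ) {b : ℝ}
    (hb : ∑ i ∈ V, ENNReal.ofReal (c i) / ENNReal.ofReal (marginal f S i) ≤
      ENNReal.ofReal b) :
    ∃ T ⊆ V, (1 - δ) * f V ≤ f T ∧ payment f c T ≤ ENNReal.ofReal (b / δ) := by
  obtain ⟨T, hTV, hfT, hT⟩ := hf.exists_subset_marginal_ge hVS hδ.le
  refine ⟨T, hTV, hfT, ?_⟩
  have hδ0 : ENNReal.ofReal δ ≠ 0 := (ENNReal.ofReal_pos.2 hδ).ne'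
  have hterm : ∀ i ∈ T, ENNReal.ofReal (c i) / ENNReal.ofReal (marginal f T i) ≤
      ENNReal.ofReal (c i) / ENNReal.ofReal (marginal f S i) * (ENNReal.ofReal δ)⁻¹ := by
    intro i hi
    calc _ ≤ ENNReal.ofReal (c i) / ENNReal.ofReal (δ * marginal f S i) :=
          ENNReal.div_le_div_left (ENNReal.ofReal_le_ofReal (hT i hi)) _
      _ = _ := by
          rw [ENNReal.ofReal_mul hδ.le, div_eq_mul_inv, div_eq_mul_inv,
            ENNReal.mul_inv (Or.inl hδ0) (Or.inl ENNReal.ofReal_ne_top), mul_assoc,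
            mul_comm (ENNReal.ofReal δ)⁻¹]
  calc payment f c T
      ≤ ∑ i ∈ T, ENNReal.ofReal (c i) / ENNReal.ofReal (marginal f S i) *
          (ENNReal.ofReal δ)⁻¹ := Finset.sum_le_sum hterm
    _ = (∑ i ∈ T, ENNReal.ofReal (c i) / ENNReal.ofReal (marginal f S i)) *
          (ENNReal.ofReal δ)⁻¹ := (Finset.sum_mul _ _ _).symm
    _ ≤ ENNReal.ofReal b * (ENNReal.ofReal δ)⁻¹ := by
          gcongr
          exact (Finset.sum_le_sum_of_subset hTV).trans hb
    _ = ENNReal.ofReal (b / δ) := by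
          rw [ENNReal.ofReal_div_of_pos hδ, div_eq_mul_inv]

theorem IsSubadditive.payment_singleton_le {α : Type*} [DecidableEq α] {f : Finset α → ℝ}
    (hf : IsSubadditive f) (hf0 : f ∅ = 0) (c : α → ℝ) {S : Finset α} {i : α} (hi : i ∈ S) :
    payment f c {i} ≤ ENNReal.ofReal (c i) / ENNReal.ofReal (marginal f S i) := by
  have h := hf {i} (S.erase i)
  rw [← Finset.insert_eq, Finset.insert_erase hi] at h
  rw [payment, Finset.sum_singleton]
  refine ENNReal.div_le_div_left (ENNReal.ofReal_le_ofReal ?_) _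
  have h0 : ({i} : Finset α).erase i = ∅ := by simp
  unfold marginal
  rw [h0, hf0]
  linarith

theorem IsBEST.mul_le_of_payment_le {α : Type*} [DecidableEq α] {f : Finset α → ℝ}
    {c : α → ℝ} {φ : Finset α → ℝ} (hφ : IsBEST f c φ) {T : Finset α} (hfT : 0 ≤ f T) {b : ℝ}
    (hb0 : 0 ≤ b) (hb1 : b ≤ 1) (hT : payment f c T ≤ ENNReal.ofReal b) :
    (1 - b) * f T ≤ φ T := by
  refine le_trans ?_ (hφ.2.2.1 T (hT.trans (ENNReal.ofReal_le_one.2 hb1)))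
  have := ENNReal.toReal_le_of_le_ofReal hb0 hT
  gcongr

/-- A set of total weight more than `t` has a subset of weight at most `t` and a further member
that takes the weight above `t`. -/
theorem exists_subset_sum_le_lt_add {α : Type*} [DecidableEq α] (w : α → ℝ) {t : ℝ}
    (ht : 0 ≤ t) (U : Finset α) (hU : t < ∑ i ∈ U, w i) :
    ∃ V ⊆ U, ∃ i ∈ U, i ∉ V ∧ ∑ j ∈ V, w j ≤ t ∧ t < ∑ j ∈ V, w j + w i := by
  induction U using Finset.induction_on with
  | empty => simp at hU; linarith
  | insert a U ha ih =>
    rw [Finset.sum_insert ha] at hU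
    by_cases h : ∑ i ∈ U, w i ≤ t
    · exact ⟨U, Finset.subset_insert a U, a, Finset.mem_insert_self a U, ha, h, by linarith⟩
    · obtain ⟨V, hV, i, hi, h'⟩ := ih (not_le.1 h)
      exact ⟨V, hV.trans (Finset.subset_insert a U), i, Finset.mem_insert_of_mem hi, h'⟩

theorem IsSubadditive.le_of_sum_le {α : Type*} [DecidableEq α] {f : Finset α → ℝ}
    (hf : IsSubadditive f) (w : α → ℝ) {t K q : ℝ} (ht : 0 ≤ t) (hK : 0 ≤ K) (hq : 0 ≤ q)
    (n : ℕ) (U : Finset α) (hV : ∀ V ⊆ U, ∑ i ∈ V, w i ≤ t → f V ≤ K)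
    (hi : ∀ i ∈ U, f {i} ≤ q) (hU : ∑ i ∈ U, w i ≤ (n + 1) * t) :
    f U ≤ K * (n + 1) + q * n := by
  induction n generalizing U with
  | zero => simpa using hV U subset_rfl (by simpa using hU)
  | succ n ih =>
    by_cases h : ∑ i ∈ U, w i ≤ t
    · refine (hV U subset_rfl h).trans ?_
      push_cast
      have : 0 ≤ K * (n + 1) + q * (n + 1) := by positivity
      linarith
    · obtain ⟨V, hVU, i, hiU, hiV, hVt, hVi⟩ :=
        exists_subset_sum_le_lt_add w ht U (not_le.1 h)
      have hsub : insert i V ⊆ U := Finset.insert_subset hiU hVU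
      have hsum := Finset.sum_sdiff (f := w) hsub
      rw [Finset.sum_insert hiV] at hsum
      have hrest := ih (U \ insert i V) (fun W hW => hV W (hW.trans Finset.sdiff_subset))
        (fun j hj => hi j (Finset.sdiff_subset hj)) (by push_cast at hU; linarith)
      have h1 := hf (U \ insert i V) (insert i V)
      rw [Finset.sdiff_union_of_subset hsub] at h1
      have h2 := hf {i} V
      rw [← Finset.insert_eq] at h2
      have h3 := hV V hVU hVt
      have h4 := hi i hiU
      push_cast
      linarith

/-- A budget-feasible set `S` of light agents has reward at most `20 * M`, where `M` bounds the
objective on all budget-feasible singletons and subsets of `S`. -/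
theorem IsBEST.reward_le_of_light {α : Type*} [DecidableEq α] {f : Finset α → ℝ} {c : α → ℝ}
    {φ : Finset α → ℝ} (hφ : IsBEST f c φ) (hf : IsXOS f) (hnn : ∀ S, 0 ≤ f S)
    (hf0 : f ∅ = 0) {B : ℝ} (hB0 : 0 ≤ B) (hB1 : B ≤ 1) {S : Finset α}
    (hSL : ∀ i ∈ S, isLight f c i) (hS : payment f c S ≤ ENNReal.ofReal B) {M : ℝ}
    (hM0 : 0 ≤ M)
    (hM : ∀ T, payment f c T ≤ ENNReal.ofReal B → (T.card = 1 ∨ T ⊆ S) → φ T ≤ M) :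
    f S ≤ 20 * M := by
  set W : α → ℝ≥0∞ := fun i => ENNReal.ofReal (c i) / ENNReal.ofReal (marginal f S i) with hW
  set w : α → ℝ := fun i => (W i).toReal with hw
  have hw0 : ∀ i, 0 ≤ w i := fun i => ENNReal.toReal_nonneg
  have hsumW : ∑ i ∈ S, W i ≤ ENNReal.ofReal B := hS
  have hfin : ∀ i ∈ S, W i ≠ ∞ := fun i hi =>
    (lt_of_le_of_lt ((Finset.single_le_sum (fun _ _ => zero_le) hi).trans hsumW)
      ENNReal.ofReal_lt_top).ne
  have hsum : ∀ V ⊆ S, ∑ i ∈ V, W i = ENNReal.ofReal (∑ i ∈ V, w i) := by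
    intro V hV
    rw [ENNReal.ofReal_sum_of_nonneg fun i _ => hw0 i]
    exact Finset.sum_congr rfl fun i hi => (ENNReal.ofReal_toReal (hfin i (hV hi))).symm
  have hwS : ∑ i ∈ S, w i ≤ B := by
    rw [hsum S subset_rfl] at hsumW
    exact (ENNReal.ofReal_le_ofReal_iff hB0).1 hsumW
  have hpay : ∀ i ∈ S, payment f c {i} ≤ ENNReal.ofReal (w i) := by
    intro i hi
    refine (hf.isSubadditive.payment_singleton_le hf0 c hi).trans ?_
    rw [ENNReal.ofReal_toReal (hfin i hi)]
  have hwB : ∀ i ∈ S, w i ≤ B := fun i hi =>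
    (Finset.single_le_sum (fun j _ => hw0 j) hi).trans hwS
  have hsingle : ∀ i ∈ S, φ {i} ≤ M := fun i hi =>
    hM {i} ((hpay i hi).trans (ENNReal.ofReal_le_ofReal (hwB i hi)))
      (Or.inl (Finset.card_singleton i))
  have hlight : ∀ i ∈ S, f {i} ≤ 2 * M := by
    intro i hi
    have h1 := hφ.mul_le_of_payment_le (hnn {i}) (by norm_num) (by norm_num) (hSL i hi)
    have h2 := hsingle i hi
    linarith
  have hbin : ∀ V ⊆ S, ∑ i ∈ V, w i ≤ B / 3 → f V ≤ 45 / 8 * M := by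
    intro V hV hVw
    obtain ⟨T, hTV, hfT, hT⟩ := hf.exists_subset_payment_le c hV (δ := 3 / 5) (by norm_num)
      ((hsum V hV).le.trans (ENNReal.ofReal_le_ofReal hVw))
    have h1 := hM T (hT.trans (ENNReal.ofReal_le_ofReal (by linarith)))
      (Or.inr (hTV.trans hV))
    have h2 := hφ.mul_le_of_payment_le (hnn T) (b := 5 / 9) (by norm_num) (by norm_num)
      (hT.trans (ENNReal.ofReal_le_ofReal (by linarith)))
    linarith
  by_cases hlarge : ∃ i ∈ S, B / 3 < w i
  · obtain ⟨i, hi, hiw⟩ := hlarge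
    have hrest := hf.isSubadditive.le_of_sum_le w (t := B / 3) (K := 45 / 8 * M) (q := 2 * M)
      (by positivity) (by positivity) (by positivity) 1 (S.erase i)
      (fun V hV => hbin V (hV.trans (Finset.erase_subset i S)))
      (fun j hj => hlight j (Finset.mem_of_mem_erase hj)) (by
        have := Finset.add_sum_erase S w hi
        push_cast
        linarith)
    have h := hf.isSubadditive {i} (S.erase i)
    rw [← Finset.insert_eq, Finset.insert_erase hi] at h
    have h2 := hlight i hi
    push_cast at hrest
    linarith
  · push Not at hlarge
    have h := hf.isSubadditive.le_of_sum_le w (t := B / 3) (K := 45 / 8 * M)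
      (q := 3 / 2 * M) (by positivity) (by positivity) (by positivity) 2 S hbin
      (fun i hi => by
        have h1 := hφ.mul_le_of_payment_le (hnn {i}) (b := 1 / 3) (by norm_num) (by norm_num)
          ((hpay i hi).trans (ENNReal.ofReal_le_ofReal (by linarith [hlarge i hi])))
        have h2 := hsingle i hi
        linarith) (by push_cast; linarith)
    push_cast at h
    linarith

/-- Removing a heavy agent from a budget-feasible set leaves light agents, a subset of which is
budget-feasible and keeps half of the remaining reward. -/
theorem IsXOS.exists_feasibleLight_of_not_isLight {α : Type*} [DecidableEq α]
    {f : Finset α → ℝ} (hf : IsXOS f) (hf0 : f ∅ = 0) {c : α → ℝ} {B : ℝ}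
    (hB1 : B ≤ 1) {X : Finset α} (hX : payment f c X ≤ ENNReal.ofReal B) {h : α} (hhX : h ∈ X)
    (hh : ¬ isLight f c h) :
    ∃ T, feasibleLight f c B T ∧ f (X.erase h) ≤ 2 * f T := by
  set W : α → ℝ≥0∞ := fun i => ENNReal.ofReal (c i) / ENNReal.ofReal (marginal f X i) with hW
  have hWh : ENNReal.ofReal (1 / 2) ≤ W h :=
    (not_le.1 hh).le.trans (hf.isSubadditive.payment_singleton_le hf0 c hhX)
  have hsplit : W h + ∑ i ∈ X.erase h, W i ≤ ENNReal.ofReal B := by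
    rw [Finset.add_sum_erase X W hhX]
    exact hX
  have hrest : ∑ i ∈ X.erase h, W i ≤ ENNReal.ofReal (B - 1 / 2) := by
    rw [ENNReal.ofReal_sub B (by norm_num)]
    refine ENNReal.le_sub_of_add_le_left ENNReal.ofReal_ne_top ?_
    exact (add_le_add_left hWh _).trans hsplit
  obtain ⟨T, hTX, hfT, hT⟩ := hf.exists_subset_payment_le c (Finset.erase_subset h X)
    (δ := 1 / 2) (by norm_num) hrest
  refine ⟨T, ⟨fun i hi => ?_, hT.trans (ENNReal.ofReal_le_ofReal (by linarith))⟩, by linarith⟩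
  have hi' := hTX hi
  calc payment f c {i} ≤ W i :=
        hf.isSubadditive.payment_singleton_le hf0 c (Finset.mem_of_mem_erase hi')
    _ ≤ ∑ i ∈ X.erase h, W i := Finset.single_le_sum (fun _ _ => zero_le) hi'
    _ ≤ ENNReal.ofReal (1 / 2) := hrest.trans (ENNReal.ofReal_le_ofReal (by linarith))

/-- **Reduction to Max-Reward-Light (XOS case).** -/
theorem reduction_to_mrl_xos {α : Type*} [DecidableEq α] [Fintype α] [Nonempty α]
    (f : Finset α → ℝ) (c : α → ℝ) (φ : Finset α → ℝ)
    (hf01 : ∀ S, f S ∈ Set.Icc (0 : ℝ) 1) (hf0 : f ∅ = 0)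
    (hxos : IsXOS f) (hc : ∀ i, 0 ≤ c i)
    (hφ : IsBEST f c φ)
    (B : ℝ) (hB0 : 0 < B) (hB1 : B ≤ 1)
    (γ : ℝ) (hγ : 1 ≤ γ)
    (S : Finset α) (hSL : ∀ i ∈ S, isLight f c i)
    (hSfeas : payment f c S ≤ ENNReal.ofReal B)
    (hSapprox : maxVal f (feasibleLight f c B) ≤ γ * f S) :
    ∃ T : Finset α,
      payment f c T ≤ ENNReal.ofReal B ∧
      (T.card = 1 ∨ T ⊆ S) ∧
      maxVal φ (feasible f c B) ≤ (40 * γ + 1) * φ T := by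
  have hempty : payment f c ∅ ≤ ENNReal.ofReal B := by simp [payment]
  have hnn : ∀ S, 0 ≤ f S := fun S => (hf01 S).1
  obtain ⟨T, hT, hmax⟩ := Set.exists_max_image
    {T | payment f c T ≤ ENNReal.ofReal B ∧ (T.card = 1 ∨ T ⊆ S)} φ (Set.toFinite _)
    ⟨∅, hempty, Or.inr (Finset.empty_subset S)⟩
  refine ⟨T, hT.1, hT.2, ?_⟩
  have hT0 : 0 ≤ φ T := hφ.1 T
  have hS : f S ≤ 20 * φ T := hφ.reward_le_of_light hxos hnn hf0 hB0.le hB1 hSL hSfeas hT0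
    fun U hU hU' => hmax U ⟨hU, hU'⟩
  have hlight : ∀ U, feasibleLight f c B U → f U ≤ 20 * γ * φ T := by
    intro U hU
    have h1 : f U ≤ maxVal f (feasibleLight f c B) :=
      le_csSup (Set.toFinite _).bddAbove ⟨U, hU, rfl⟩
    have h2 : γ * f S ≤ γ * (20 * φ T) := by gcongr
    linarith
  have hγT : 0 ≤ γ * φ T := by positivity
  refine csSup_le ⟨φ ∅, ∅, hempty, rfl⟩ ?_
  rintro _ ⟨X, hX, rfl⟩
  by_cases hXL : ∀ i ∈ X, isLight f c i
  · have h1 := hlight X ⟨hXL, hX⟩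
    have h2 := hφ.2.1 X
    linarith
  · push Not at hXL
    obtain ⟨h, hhX, hh⟩ := hXL
    obtain ⟨U, hU, hfU⟩ := hxos.exists_feasibleLight_of_not_isLight hf0 hB1 hX hhX hh
    have h1 := hlight U hU
    have h2 := hφ.2.2.2 X h hhX
    have hpay : payment f c {h} ≤ ENNReal.ofReal B :=
      (hxos.isSubadditive.payment_singleton_le hf0 c hhX).trans
        ((Finset.single_le_sum (f := fun i => ENNReal.ofReal (c i) /
          ENNReal.ofReal (marginal f X i)) (fun _ _ => zero_le) hhX).trans hX)
    have h3 := hmax {h} ⟨hpay, Or.inl (Finset.card_singleton h)⟩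
    linarith
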